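/- Let R be an associative unital ring (not necessarily commutative), α : ℤ → R a family of elements, and S_s^k(n) the associated non-commutative Svinin polynomials. Then for every integer r ≥ 1 and every n ∈ ℤ, α_n · (S_{r+1}^r(n+r) − S_r^r(n+r)) = (S_{r+1}^r(n+r−1) − S_r^r(n+r−2)) · α_n. -/

import Mathlib

/-- Non-commutative Svinin polynomials: `svinin α s k n` is `S_s^k(n)`, defined by
`S_s^0(n) = 1` and `S_s^k(n) = Σ_{j=0}^{s−1} α_{n−k−j+1} · S_{s−j}^{k−1}(n−j)` for `k ≥ 1`. -/
def svinin {R : Type*} [Ring R] (α : ℤ → R) : ℕ → ℕ → ℤ → R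
  | _, 0, _ => 1
  | s, k + 1, n =>
      ∑ j ∈ Finset.range s,
        α (n - ((k : ℤ) + 1) - (j : ℤ) + 1) * svinin α (s - j) k (n - (j : ℤ))

theorem svinin_k_zero {R : Type*} [Ring R] (α : ℤ → R) (s : ℕ) (n : ℤ) :
    svinin α s 0 n = 1 := by
  simp [svinin]

theorem svinin_s_zero {R : Type*} [Ring R] (α : ℤ → R) (k : ℕ) (n : ℤ) :
    svinin α 0 (k + 1) n = 0 := by
  simp [svinin]

/-- Splitting off the first letter. -/
theorem svinin_left {R : Type*} [Ring R] (α : ℤ → R) (s k : ℕ) (n : ℤ) :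
    svinin α (s + 1) (k + 1) n =
      svinin α s (k + 1) (n - 1) + α (n - k) * svinin α (s + 1) k n := by
  rw [svinin, svinin, Finset.sum_range_succ']
  congr 1
  · refine Finset.sum_congr rfl fun j _ => ?_
    rw [Nat.add_sub_add_right]
    congr 2 <;> push_cast <;> ring
  · simp only [Nat.cast_zero, sub_zero, Nat.sub_zero]
    congr 2
    ring

/-- Splitting off the last letter. -/
theorem svinin_right {R : Type*} [Ring R] (α : ℤ → R) (k : ℕ) : ∀ (s : ℕ) (n : ℤ),
    svinin α (s + 1) (k + 1) n =
      svinin α s (k + 1) n + svinin α (s + 1) k (n - 1) * α (n - s) := by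
  induction k with
  | zero =>
    intro s
    induction s with
    | zero => intro n; rw [svinin_left]; simp [svinin_s_zero, svinin_k_zero]
    | succ t ih =>
      intro n
      rw [svinin_left, ih, svinin_left α t]
      simp only [svinin_k_zero]
      rw [show n - 1 - (t : ℤ) = n - ((t + 1 : ℕ) : ℤ) by push_cast; ring]
      noncomm_ring
  | succ k ihk =>
    intro s
    induction s with
    | zero =>
      intro n
      rw [svinin_left, ihk, svinin_left α 0 k (n - 1)]
      simp only [svinin_s_zero]
      rw [show n - 1 - (k : ℤ) = n - ((k + 1 : ℕ) : ℤ) by push_cast; ring]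
      noncomm_ring
    | succ t ih =>
      intro n
      rw [svinin_left, ih, svinin_left α t (k + 1) n, ihk (t + 1) n,
        svinin_left α (t + 1) k (n - 1)]
      rw [show n - 1 - (t : ℤ) = n - ((t + 1 : ℕ) : ℤ) by push_cast; ring,
        show n - 1 - (k : ℤ) = n - ((k + 1 : ℕ) : ℤ) by push_cast; ring]
      noncomm_ring

/-- For every `r ≥ 1` and `n ∈ ℤ`:
`α_n · (S_{r+1}^r(n+r) − S_r^r(n+r)) = (S_{r+1}^r(n+r−1) − S_r^r(n+r−2)) · α_n`. -/
theorem svinin_conjugation_identity {R : Type*} [Ring R] (α : ℤ → R)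
    (r : ℕ) (hr : 1 ≤ r) (n : ℤ) :
    α n * (svinin α (r + 1) r (n + r) - svinin α r r (n + r)) =
      (svinin α (r + 1) r (n + r - 1) - svinin α r r (n + r - 2)) * α n := by
  obtain ⟨k, rfl⟩ : ∃ k, r = k + 1 := ⟨r - 1, by omega⟩
  rw [svinin_right α k (k + 1) (n + ((k + 1 : ℕ) : ℤ)),
    svinin_left α (k + 1) k (n + ((k + 1 : ℕ) : ℤ) - 1),
    show n + ((k + 1 : ℕ) : ℤ) - 1 - 1 = n + ((k + 1 : ℕ) : ℤ) - 2 by ring,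
    show n + ((k + 1 : ℕ) : ℤ) - ((k + 1 : ℕ) : ℤ) = n by ring,
    show n + ((k + 1 : ℕ) : ℤ) - 1 - (k : ℤ) = n by push_cast; ring,
    add_sub_cancel_left, add_sub_cancel_left, mul_assoc]
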